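/- Let ν > 1 and let ξ : ℝ → (0,1) be the solution of dξ/dy = ξ^(ν+1)(1−ξ) with ξ(0) = (ν+1)/(ν+2). Then ξ(y)·|y|^(1/ν) → ν^(−1/ν) as y → −∞. -/

import Mathlib

open Filter

/-- Lower growth bound from a one-sided derivative bound on `Iic Y`. -/
lemma growth_aux (w w' : ℝ → ℝ) (hw : ∀ y, HasDerivAt w (w' y) y) (b Y : ℝ)
    (hb : ∀ y ≤ Y, w' y ≤ -b) (y : ℝ) (hy : y ≤ Y) : w Y + b * (Y - y) ≤ w y := by
  have hd : ∀ y, HasDerivAt (fun y => w y + b * y) (w' y + b * 1) y := fun y =>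
    (hw y).add ((hasDerivAt_id y).const_mul b)
  have h : AntitoneOn (fun y => w y + b * y) (Set.Iic Y) := by
    apply antitoneOn_of_deriv_nonpos (convex_Iic Y)
    · exact fun z _ => (hd z).continuousAt.continuousWithinAt
    · exact fun z _ => (hd z).differentiableAt.differentiableWithinAt
    · intro z hz
      rw [interior_Iic] at hz
      rw [(hd z).deriv]
      have := hb z (le_of_lt hz)
      linarith
  have := h (show y ∈ Set.Iic Y from hy) (show Y ∈ Set.Iic Y from le_refl Y) hy
  simp only at this
  linarith

/-- For the profile ξ' = ξ^(ν+1)(1−ξ), ξ(0) = (ν+1)/(ν+2), one has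
ξ(y)|y|^(1/ν) → ν^(−1/ν) as y → −∞. -/
theorem stmt2 (ν : ℝ) (hν : 1 < ν) (ξ : ℝ → ℝ)
    (hmem : ∀ y, ξ y ∈ Set.Ioo (0:ℝ) 1)
    (hode : ∀ y, HasDerivAt ξ ((ξ y) ^ (ν + 1) * (1 - ξ y)) y)
    (h0 : ξ 0 = (ν + 1) / (ν + 2)) :
    Tendsto (fun y => ξ y * |y| ^ (1 / ν)) atBot (nhds (ν ^ (-(1 / ν)))) := by
  have hν0 : 0 < ν := by linarith
  have hpos : ∀ y, 0 < ξ y := fun y => (hmem y).1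
  have hlt : ∀ y, ξ y < 1 := fun y => (hmem y).2
  have hmono : Monotone ξ := by
    apply monotone_of_deriv_nonneg (fun y => (hode y).differentiableAt)
    intro y
    rw [(hode y).deriv]
    exact mul_nonneg (Real.rpow_nonneg (hpos y).le _) (by linarith [hlt y])
  obtain ⟨w, hwdef⟩ : ∃ w : ℝ → ℝ, w = fun y => (ξ y) ^ (-ν) := ⟨_, rfl⟩
  have hwpos : ∀ y, 0 < w y := fun y => by rw [hwdef]; exact Real.rpow_pos_of_pos (hpos y) _
  have hξw : ∀ y, ξ y = (w y) ^ (-(1 / ν)) := fun y => by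
    rw [hwdef]
    simp only
    rw [← Real.rpow_mul (hpos y).le]
    have : -ν * -(1 / ν) = 1 := by field_simp
    rw [this, Real.rpow_one]
  have hw : ∀ y, HasDerivAt w (-ν * (1 - ξ y)) y := fun y => by
    rw [hwdef]
    have h := (hode y).rpow_const (p := -ν) (Or.inl (hpos y).ne')
    convert h using 1
    have h1 : ξ y ^ (ν + 1) * ξ y ^ (-ν - 1) = 1 := by
      rw [← Real.rpow_add (hpos y)]
      have : ν + 1 + (-ν - 1) = 0 := by ring
      rw [this, Real.rpow_zero]
    linear_combination (ν * (1 - ξ y)) * h1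
  -- divergence of w
  have hc : 0 < ν * (1 - ξ 0) := mul_pos hν0 (by linarith [hlt 0])
  have hwtop : Tendsto w atBot atTop := by
    have h1 : Tendsto (fun y : ℝ => w 0 + ν * (1 - ξ 0) * (0 - y)) atBot atTop := by
      apply tendsto_atTop_add_const_left
      apply Tendsto.const_mul_atTop hc
      exact (tendsto_neg_atBot_atTop : Tendsto (fun y : ℝ => -y) atBot atTop).congr (fun y => (zero_sub y).symm)
    apply tendsto_atTop_mono' _ _ h1
    filter_upwards [eventually_le_atBot (0:ℝ)] with y hy
    apply growth_aux w _ hw _ 0 _ y hy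
    intro z hz
    have := hmono hz
    nlinarith
  have hξ0 : Tendsto ξ atBot (nhds 0) := by
    have := (tendsto_rpow_neg_atTop (y := 1 / ν) (by positivity)).comp hwtop
    exact this.congr (fun y => (hξw y).symm)
  have hup : ∀ y ≤ 0, w y ≤ w 0 + ν * (-y) := by
    intro y hy
    have h := growth_aux (fun y => -w y) _ (fun y => (hw y).neg) (-ν) 0 (by
      intro z _
      have := hpos z
      nlinarith) y hy
    linarith
  have hneg : Tendsto (fun y : ℝ => -y) atBot atTop := tendsto_neg_atBot_atTop
  have hlim : Tendsto (fun y => w y / (-y)) atBot (nhds ν) := by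
    rw [tendsto_order]
    constructor
    · intro a ha
      obtain ⟨b, hab, hbν⟩ := exists_between ha
      have he : 0 < (ν - b) / ν := div_pos (by linarith) hν0
      obtain ⟨Y, hY⟩ := eventually_atBot.1 (hξ0.eventually (gt_mem_nhds he))
      have hbd : ∀ y ≤ Y, w Y + b * (Y - y) ≤ w y := by
        apply growth_aux w _ hw
        intro z hz
        have := hY z hz
        rw [lt_div_iff₀ hν0] at this
        nlinarith
      have hev := (hneg.const_mul_atTop (sub_pos.2 hab)).eventually_gt_atTop (-(w Y + b * Y))
      filter_upwards [hev, eventually_le_atBot Y, eventually_lt_atBot (0:ℝ)] with y h1 h2 h3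
      rw [lt_div_iff₀ (by linarith)]
      have := hbd y h2
      nlinarith
    · intro a ha
      have hev := (hneg.const_mul_atTop (sub_pos.2 ha)).eventually_gt_atTop (w 0)
      filter_upwards [hev, eventually_lt_atBot (0:ℝ)] with y h1 h3
      rw [div_lt_iff₀ (by linarith)]
      have := hup y h3.le
      nlinarith
  have hfin := hlim.rpow_const (p := -(1 / ν)) (Or.inl hν0.ne')
  refine hfin.congr' ?_
  filter_upwards [eventually_lt_atBot (0:ℝ)] with y hy
  rw [abs_of_neg hy, Real.div_rpow (hwpos y).le (by linarith), ← hξw,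
    Real.rpow_neg (by linarith : (0:ℝ) ≤ -y), div_inv_eq_mul]
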